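/- arXiv:2009.08860 — 2 statements merged into one kernel-verified Lean document; each statement's English description precedes it below -/
import Mathlib

section
/- Let g be a Riemannian metric on an open set U ⊆ ℝ³, let ξ be a smooth vector field on U with |ξ|²_g > 0, Euclidean divergence div ξ = 0, and which is a g-Killing field ((L_ξ g)_{ij} = 0 on U). Let C : ℝ → ℝ be smooth and ψ : U → ℝ smooth with ξ · ∇ψ = 0 on U. Define ∇⊥_gψ := ξ ×_g ∇_gψ and B_g := |ξ|_g^{-2}(C(ψ) ξ + √|g| ∇⊥_gψ). Then the Lie derivative of the Euclidean squared magnitude of B_g along ξ satisfies ξ · ∇(|B_g|²) = (L_ξ δ)(B_g, B_g) = |ξ|_g^{-4} [ C(ψ)² (L_ξ δ)(ξ, ξ) + 2 √|g| C(ψ) (L_ξ δ)(ξ, ∇⊥_gψ) + |g| (L_ξ δ)(∇⊥_gψ, ∇⊥_gψ) ], where |B_g|² is the Euclidean squared norm and (L_ξ δ)(A, B) := A^i(∂_i ξ^j + ∂_j ξ^i)B^j is the Euclidean deformation tensor of ξ. In particular, B_g is weakly quasisymmetric with respect to ξ (ξ · ∇|B_g| = 0 wherever B_g ≠ 0) if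 and only if C(ψ)²(L_ξδ)(ξ,ξ) + 2√|g| C(ψ)(L_ξδ)(ξ,∇⊥_gψ) + |g|(L_ξδ)(∇⊥_gψ,∇⊥_gψ) = 0. -/
noncomputable section

/-- Points of `ℝ³`. -/
abbrev Pt : Type := Fin 3 → ℝ

/-- Vector fields on `ℝ³`. -/
abbrev VF : Type := Pt → Pt

/-- A (matrix-valued) metric on `ℝ³`. -/
abbrev Met3 : Type := Pt → Matrix (Fin 3) (Fin 3) ℝ

/-- Partial derivative `∂ᵢ f` in the standard coordinates. -/
def pd (i : Fin 3) (f : Pt → ℝ) (x : Pt) : ℝ := fderiv ℝ f x (Pi.single i 1)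

/-- The Levi-Civita symbol `ε_{ijk}`. -/
def eps (i j k : Fin 3) : ℝ :=
  ((j.val : ℝ) - (i.val : ℝ)) * ((k.val : ℝ) - (i.val : ℝ)) * ((k.val : ℝ) - (j.val : ℝ)) / 2

/-- `g` is a smooth Riemannian metric on `U`: smooth coefficients, symmetric
positive-definite at every point of `U`. -/
def SmoothMetricOn (g : Met3) (U : Set Pt) : Prop :=
  (∀ i j, ContDiffOn ℝ (⊤ : ℕ∞) (fun x => g x i j) U) ∧ (∀ x ∈ U, (g x).PosDef)

/-- `√|g|`, square root of the determinant of the metric. -/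
def sdet (g : Met3) (x : Pt) : ℝ := Real.sqrt (g x).det

/-- Metric dot product `X ·_g Y = g_{ij} X^i Y^j`. -/
def gdot (g : Met3) (X Y : VF) (x : Pt) : ℝ := ∑ i, ∑ j, g x i j * X x i * Y x j

/-- `|X|²_g`. -/
def gnormSq (g : Met3) (X : VF) (x : Pt) : ℝ := gdot g X X x

/-- Metric gradient `(∇_g f)^i = g^{ij} ∂_j f`. -/
def ggrad (g : Met3) (f : Pt → ℝ) : VF := fun x i => ∑ j, (g x)⁻¹ i j * pd j f x

/-- Metric cross product `(X ×_g Y)^k = √|g| g^{kℓ} ε_{ijℓ} X^i Y^j`. -/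
def gcross (g : Met3) (X Y : VF) : VF :=
  fun x k => sdet g x * ∑ l, ∑ i, ∑ j, (g x)⁻¹ k l * eps i j l * X x i * Y x j

/-- Metric divergence `div_g X = |g|^{-1/2} ∂_i(√|g| X^i)`. -/
def gdiv (g : Met3) (X : VF) (x : Pt) : ℝ :=
  (sdet g x)⁻¹ * ∑ i, pd i (fun y => sdet g y * X y i) x

/-- Metric curl `(curl_g X)^m = √|g| g^{mn} g^{ik} g^{jℓ} ε_{kℓn} ∂_i(g_{jp}X^p)`. -/
def gcurl (g : Met3) (X : VF) : VF :=
  fun x m => sdet g x * ∑ n, ∑ i, ∑ k, ∑ j, ∑ l,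
    (g x)⁻¹ m n * (g x)⁻¹ i k * (g x)⁻¹ j l * eps k l n *
      pd i (fun y => ∑ p, g y j p * X y p) x

/-- Christoffel symbols `Γ^k_{ij}`. -/
def christoffel (g : Met3) (x : Pt) (k i j : Fin 3) : ℝ :=
  (1 / 2) * ∑ l, (g x)⁻¹ k l *
    (pd i (fun y => g y j l) x + pd j (fun y => g y i l) x - pd l (fun y => g y i j) x)

/-- Covariant derivative `(∇_X Y)^i = X^j ∂_j Y^i + Γ^i_{jk} X^j Y^k`. -/
def covD (g : Met3) (X Y : VF) : VF :=
  fun x i => (∑ j, X x j * pd j (fun y => Y y i) x)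
    + ∑ j, ∑ k, christoffel g x i j k * X x j * Y x k

/-- Lie derivative of a vector field, `(L_X Y)^i = X^j ∂_j Y^i − Y^j ∂_j X^i`. -/
def lieVF (X Y : VF) : VF :=
  fun x i => (∑ j, X x j * pd j (fun y => Y y i) x) - ∑ j, Y x j * pd j (fun y => X y i) x

/-- Deformation tensor `(L_X g)_{ij} = ∂_i(g_{jℓ}X^ℓ) + ∂_j(g_{iℓ}X^ℓ) − 2Γ^k_{ij} g_{kℓ}X^ℓ`. -/
def lieMet (g : Met3) (X : VF) (x : Pt) (i j : Fin 3) : ℝ :=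
  pd i (fun y => ∑ l, g y j l * X y l) x + pd j (fun y => ∑ l, g y i l * X y l) x
    - 2 * ∑ k, ∑ l, christoffel g x k i j * g x k l * X x l

/-- Pairing `(L_X g)(A, B) = (L_X g)_{ij} A^i B^j`. -/
def lieMetPair (g : Met3) (X A B : VF) (x : Pt) : ℝ :=
  ∑ i, ∑ j, lieMet g X x i j * A x i * B x j

/-- `ξ` is a `g`-Killing field on `U`. -/
def IsKillingOn (g : Met3) (ξ : VF) (U : Set Pt) : Prop :=
  ∀ x ∈ U, ∀ i j, lieMet g ξ x i j = 0

/-- Euclidean dot product. -/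
def edot (X Y : VF) (x : Pt) : ℝ := ∑ i, X x i * Y x i

/-- Euclidean gradient. -/
def egrad (f : Pt → ℝ) : VF := fun x i => pd i f x

/-- Euclidean cross product. -/
def ecross (X Y : VF) : VF := fun x k => ∑ i, ∑ j, eps i j k * X x i * Y x j

/-- Euclidean divergence. -/
def ediv (X : VF) (x : Pt) : ℝ := ∑ i, pd i (fun y => X y i) x

/-- Euclidean curl. -/
def ecurl (X : VF) : VF := fun x m => ∑ i, ∑ j, eps i j m * pd i (fun y => X y j) x

/-- Euclidean deformation tensor pairing `(L_ξ δ)(A,B) = A^i (∂_i ξ^j + ∂_j ξ^i) B^j`. -/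
def lieEuclPair (ξ A B : VF) (x : Pt) : ℝ :=
  ∑ i, ∑ j, A x i * (pd i (fun y => ξ y j) x + pd j (fun y => ξ y i) x) * B x j

/-- The magnetic field ansatz `B_g = |ξ|_g^{-2} (C(ψ) ξ + √|g| (ξ ×_g ∇_g ψ))`. -/
def Bg (g : Met3) (ξ : VF) (C : ℝ → ℝ) (ψ : Pt → ℝ) : VF :=
  fun x i => (gnormSq g ξ x)⁻¹ * (C (ψ x) * ξ x i + sdet g x * gcross g ξ (ggrad g ψ) x i)


/-- Directional derivative expressed through partial derivatives. -/
theorem dir_eq (ξ : VF) (f : Pt → ℝ) (x : Pt) :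
    edot ξ (egrad f) x = fderiv ℝ f x (ξ x) := by
  have h : ξ x = ∑ i, ξ x i • (Pi.single i 1 : Pt) := by
    ext k
    simp [Finset.sum_apply, Pi.single_apply]
  conv_rhs => rw [h]
  simp [edot, egrad, pd]

theorem fd_mul {f h : Pt → ℝ} {x : Pt} (hf : DifferentiableAt ℝ f x)
    (hh : DifferentiableAt ℝ h x) (v : Pt) :
    fderiv ℝ (fun y => f y * h y) x v = f x * fderiv ℝ h x v + h x * fderiv ℝ f x v := by
  rw [fderiv_fun_mul hf hh]
  simp

theorem fd_sum {f : Fin 3 → Pt → ℝ} {x : Pt} (hf : ∀ i, DifferentiableAt ℝ (f i) x) (v : Pt) :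
    fderiv ℝ (fun y => ∑ i, f i y) x v = ∑ i, fderiv ℝ (f i) x v := by
  rw [fderiv_fun_sum (fun i _ => hf i)]
  simp

/-- The metric cross product collapses: `√|g| ξ ×_g ∇_g ψ = (g ξ) × dψ`. -/
theorem cross_simp (g : Met3) (ξ : VF) (ψ : Pt → ℝ) (x : Pt) (hg : (g x).PosDef) (k : Fin 3) :
    sdet g x * gcross g ξ (ggrad g ψ) x k =
      (∑ l, g x (k+1) l * ξ x l) * pd (k+2) ψ x - (∑ l, g x (k+2) l * ξ x l) * pd (k+1) ψ x := by
  have hdet : 0 < (g x).det := hg.det_pos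
  have hs : sdet g x * sdet g x = (g x).det := Real.mul_self_sqrt hdet.le
  have hsym : ∀ i j, g x i j = g x j i := by
    intro i j
    have := hg.isHermitian.apply j i
    simpa using this
  set q : Pt := ggrad g ψ x with hq
  have hp : ∀ i, pd i ψ x = ∑ j, g x i j * q j := by
    intro i
    have h1 : g x * (g x)⁻¹ = 1 := Matrix.mul_nonsing_inv _ hdet.ne'.isUnit
    have h2 : (g x).mulVec ((g x)⁻¹.mulVec (fun j => pd j ψ x)) = fun j => pd j ψ x := by
      rw [Matrix.mulVec_mulVec, h1, Matrix.one_mulVec]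
    exact (congrFun h2 i).symm
  have hinv : ∀ i j, (g x).det * (g x)⁻¹ i j = (g x).adjugate i j := by
    intro i j
    rw [Matrix.inv_def]
    simp [hdet.ne']
  have e : sdet g x * gcross g ξ (ggrad g ψ) x k =
      ∑ l, ∑ i, ∑ j, (g x).adjugate k l * eps i j l * ξ x i * q j := by
    unfold gcross
    rw [← mul_assoc, hs, Finset.mul_sum]
    refine Finset.sum_congr rfl fun l _ => ?_
    rw [Finset.mul_sum]
    refine Finset.sum_congr rfl fun i _ => ?_
    rw [Finset.mul_sum]
    refine Finset.sum_congr rfl fun j _ => ?_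
    rw [← hinv]
    ring
  rw [e, hp, hp]
  clear_value q
  have h10 := hsym 1 0
  have h20 := hsym 2 0
  have h21 := hsym 2 1
  fin_cases k <;>
    simp [Fin.sum_univ_three, Matrix.adjugate_fin_three, eps, h10, h20, h21] <;> ring

/-- The Killing equation in Lie-derivative form. -/
theorem killing_simp (g : Met3) (ξ : VF) (x : Pt) (hg : (g x).PosDef)
    (hgd : ∀ i j, DifferentiableAt ℝ (fun y => g y i j) x)
    (hξd : ∀ i, DifferentiableAt ℝ (fun y => ξ y i) x)
    (i j : Fin 3) (hk : lieMet g ξ x i j = 0) :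
    fderiv ℝ (fun y => g y i j) x (ξ x) =
      - ∑ l, (g x j l * pd i (fun y => ξ y l) x + g x i l * pd j (fun y => ξ y l) x) := by
  have hdet : 0 < (g x).det := hg.det_pos
  have hsym : ∀ i j, g x i j = g x j i := by
    intro i j
    have := hg.isHermitian.apply j i
    simpa using this
  have h1 : (g x) * (g x)⁻¹ = 1 := Matrix.mul_nonsing_inv _ hdet.ne'.isUnit
  have hpd : ∀ a b, pd a (fun y => ∑ l, g y b l * ξ y l) x =
      ∑ l, (g x b l * pd a (fun y => ξ y l) x + ξ x l * pd a (fun y => g y b l) x) := by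
    intro a b
    unfold pd
    rw [fd_sum (fun l => (hgd b l).fun_mul (hξd l))]
    exact Finset.sum_congr rfl fun l _ => fd_mul (hgd b l) (hξd l) _
  have hch : 2 * ∑ k, ∑ l, christoffel g x k i j * g x k l * ξ x l =
      ∑ m, (pd i (fun y => g y j m) x + pd j (fun y => g y i m) x
        - pd m (fun y => g y i j) x) * ξ x m := by
    have hd : ∀ l m, ∑ k, g x k l * (g x)⁻¹ k m = if l = m then 1 else 0 := by
      intro l m
      have := congrFun (congrFun h1 l) m
      rw [Matrix.mul_apply, Matrix.one_apply] at this
      rw [← this]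
      exact Finset.sum_congr rfl fun k _ => by rw [hsym k l]
    unfold christoffel
    obtain ⟨T, hT⟩ : ∃ T : Fin 3 → ℝ, ∀ m, pd i (fun y => g y j m) x + pd j (fun y => g y i m) x
        - pd m (fun y => g y i j) x = T m := ⟨_, fun _ => rfl⟩
    simp only [hT]
    have : ∀ l, (∑ m, (∑ k, g x k l * (g x)⁻¹ k m) * T m) * ξ x l = T l * ξ x l := by
      intro l; simp [hd]
    rw [← Finset.sum_congr rfl fun l _ => this l]
    simp only [Fin.sum_univ_three]
    ring
  have hdir := dir_eq ξ (fun y => g y i j) x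
  rw [← hdir]
  unfold lieMet at hk
  rw [hpd, hpd, hch] at hk
  simp only [edot, egrad, Fin.sum_univ_three] at hk ⊢
  linarith

/-- Directional derivative of `dψ` along `ξ` when `ξ · ∇ψ = 0`. -/
theorem dpsi_simp (U : Set Pt) (hU : IsOpen U) (ξ : VF) (ψ : Pt → ℝ) (x : Pt) (hx : x ∈ U)
    (hξd : ∀ i, DifferentiableAt ℝ (fun y => ξ y i) x)
    (hψ : ContDiffAt ℝ (⊤ : ℕ∞) ψ x)
    (horth : ∀ x ∈ U, edot ξ (egrad ψ) x = 0) (k : Fin 3) :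
    DifferentiableAt ℝ (fun y => pd k ψ y) x ∧
    fderiv ℝ (fun y => pd k ψ y) x (ξ x) = - ∑ j, pd j ψ x * pd k (fun y => ξ y j) x := by
  have hd1 : DifferentiableAt ℝ (fderiv ℝ ψ) x :=
    (hψ.fderiv_right (m := 1) (by norm_cast)).differentiableAt (by norm_num)
  have hpd : ∀ j, DifferentiableAt ℝ (fun y => pd j ψ y) x := fun j =>
    hd1.clm_apply (differentiableAt_const _)
  have hpv : ∀ j v, fderiv ℝ (fun y => pd j ψ y) x v
      = fderiv ℝ (fderiv ℝ ψ) x v (Pi.single j 1) := by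
    intro j v
    unfold pd
    rw [fderiv_clm_apply hd1 (differentiableAt_const _)]
    simp
  have hsymm : IsSymmSndFDerivAt ℝ ψ x := hψ.isSymmSndFDerivAt (by
    rw [minSmoothness_of_isRCLikeNormedField]
    exact WithTop.coe_le_coe.2 (le_top : (2 : ℕ∞) ≤ ⊤))
  refine ⟨hpd k, ?_⟩
  have h0 : pd k (edot ξ (egrad ψ)) x = 0 := by
    have : edot ξ (egrad ψ) =ᶠ[nhds x] fun _ => 0 := by
      filter_upwards [hU.mem_nhds hx] with y hy using horth y hy
    unfold pd
    rw [this.fderiv_eq]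
    simp
  have h1 : pd k (edot ξ (egrad ψ)) x = ∑ j, (ξ x j * pd k (fun y => pd j ψ y) x
      + pd j ψ x * pd k (fun y => ξ y j) x) := by
    have e : edot ξ (egrad ψ) = fun y => ∑ j, ξ y j * pd j ψ y := rfl
    rw [e]
    change fderiv ℝ (fun y => ∑ j, ξ y j * pd j ψ y) x (Pi.single k 1) = _
    rw [fd_sum (fun l => (hξd l).fun_mul (hpd l))]
    exact Finset.sum_congr rfl fun l _ => fd_mul (hξd l) (hpd l) _
  have h2 : ∀ j, pd k (fun y => pd j ψ y) x = pd j (fun y => pd k ψ y) x := by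
    intro j
    have := hsymm (Pi.single k 1) (Pi.single j 1)
    change fderiv ℝ (fun y => pd j ψ y) x _ = fderiv ℝ (fun y => pd k ψ y) x _
    rw [hpv, hpv, this]
  rw [← dir_eq]
  rw [h1] at h0
  simp only [h2, Finset.sum_add_distrib] at h0
  simp only [edot, egrad]
  linarith

/-- `B_g` is differentiable and Lie-transported by `ξ`. -/
theorem Bg_transport (U : Set Pt) (hU : IsOpen U)
    (g : Met3) (hg : SmoothMetricOn g U)
    (ξ : VF) (hξ : ContDiffOn ℝ (⊤ : ℕ∞) ξ U) (hξpos : ∀ x ∈ U, 0 < gnormSq g ξ x)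
    (hdivξ : ∀ x ∈ U, ediv ξ x = 0) (hKill : IsKillingOn g ξ U)
    (C : ℝ → ℝ) (hC : ContDiff ℝ (⊤ : ℕ∞) C)
    (ψ : Pt → ℝ) (hψ : ContDiffOn ℝ (⊤ : ℕ∞) ψ U)
    (horth : ∀ x ∈ U, edot ξ (egrad ψ) x = 0) (x : Pt) (hx : x ∈ U) (k : Fin 3) :
    DifferentiableAt ℝ (fun y => Bg g ξ C ψ y k) x ∧
    fderiv ℝ (fun y => Bg g ξ C ψ y k) x (ξ x) =
      ∑ j, Bg g ξ C ψ x j * pd j (fun y => ξ y k) x := by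
  have hUx := hU.mem_nhds hx
  have hgd : ∀ i j, DifferentiableAt ℝ (fun y => g y i j) x := fun i j =>
    ((hg.1 i j).contDiffAt hUx).differentiableAt (by simp)
  have hξd' : DifferentiableAt ℝ ξ x := (hξ.contDiffAt hUx).differentiableAt (by simp)
  have hξd : ∀ i, DifferentiableAt ℝ (fun y => ξ y i) x := fun i =>
    differentiableAt_pi.1 hξd' i
  have hψx := hψ.contDiffAt hUx
  have hψd : DifferentiableAt ℝ ψ x := hψx.differentiableAt (by simp)
  have hp := dpsi_simp U hU ξ ψ x hx hξd hψx horth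
  have hK := fun i j => killing_simp g ξ x (hg.2 x hx) hgd hξd i j (hKill x hx i j)
  have hDξ : ∀ i, fderiv ℝ (fun y => ξ y i) x (ξ x) = ∑ j, ξ x j * pd j (fun y => ξ y i) x :=
    fun i => (dir_eq ξ _ x).symm
  -- lowered field
  set η : Fin 3 → Pt → ℝ := fun i y => ∑ l, g y i l * ξ y l with hη
  have hηd : ∀ i, DifferentiableAt ℝ (η i) x := fun i =>
    DifferentiableAt.fun_sum fun l _ => (hgd i l).fun_mul (hξd l)
  have hDη : ∀ i, fderiv ℝ (η i) x (ξ x) = - ∑ j, η j x * pd i (fun y => ξ y j) x := by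
    intro i
    have hsym : ∀ i j, g x i j = g x j i := by
      intro i j
      have := (hg.2 x hx).isHermitian.apply j i
      simpa using this
    rw [hη]
    simp only
    rw [fd_sum (fun l => (hgd i l).fun_mul (hξd l))]
    rw [Finset.sum_congr rfl fun l _ => fd_mul (hgd i l) (hξd l) (ξ x)]
    simp only [hK, hDξ, Fin.sum_univ_three]
    rw [hsym 1 0, hsym 2 0, hsym 2 1]
    ring
  -- norm
  have hN : gnormSq g ξ = fun y => ∑ i, η i y * ξ y i := by
    funext y
    simp only [gnormSq, gdot, hη, Fin.sum_univ_three]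
    ring
  have hNd : DifferentiableAt ℝ (gnormSq g ξ) x := by
    rw [hN]
    exact DifferentiableAt.fun_sum fun l _ => (hηd l).fun_mul (hξd l)
  have hDN : fderiv ℝ (gnormSq g ξ) x (ξ x) = 0 := by
    rw [hN, fd_sum (fun l => (hηd l).fun_mul (hξd l))]
    rw [Finset.sum_congr rfl fun l _ => fd_mul (hηd l) (hξd l) (ξ x)]
    simp only [hDη, hDξ, Fin.sum_univ_three]
    ring
  have hN0 : gnormSq g ξ x ≠ 0 := (hξpos x hx).ne'
  have hDψ : fderiv ℝ ψ x (ξ x) = 0 := by rw [← dir_eq]; exact horth x hx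
  have hCd : DifferentiableAt ℝ C (ψ x) := (hC.differentiable (by simp)) _
  have hCψd : DifferentiableAt ℝ (fun y => C (ψ y)) x := hCd.fun_comp' x hψd
  have hDC : fderiv ℝ (fun y => C (ψ y)) x (ξ x) = 0 := by
    rw [show (fun y => C (ψ y)) = C ∘ ψ from rfl, fderiv_comp x hCd hψd]
    simp [hDψ]
  -- polynomial form
  have hform : ∀ y ∈ U, ∀ k, Bg g ξ C ψ y k = (gnormSq g ξ y)⁻¹ * (C (ψ y) * ξ y k +
      (η (k+1) y * pd (k+2) ψ y - η (k+2) y * pd (k+1) ψ y)) := by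
    intro y hy k
    unfold Bg
    rw [cross_simp g ξ ψ y (hg.2 y hy) k]
  have hev : (fun y => Bg g ξ C ψ y k) =ᶠ[nhds x] fun y => (gnormSq g ξ y)⁻¹ *
      (C (ψ y) * ξ y k + (η (k+1) y * pd (k+2) ψ y - η (k+2) y * pd (k+1) ψ y)) := by
    filter_upwards [hUx] with y hy using hform y hy k
  have hNi : DifferentiableAt ℝ (fun y => (gnormSq g ξ y)⁻¹) x := hNd.fun_inv hN0
  have hDNi : fderiv ℝ (fun y => (gnormSq g ξ y)⁻¹) x (ξ x) = 0 := by
    rw [show (fun y => (gnormSq g ξ y)⁻¹) = Inv.inv ∘ gnormSq g ξ from rfl,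
      ((hasDerivAt_inv hN0).comp_hasFDerivAt x hNd.hasFDerivAt).fderiv]
    simp [hDN]
  have ha := hCψd.fun_mul (hξd k)
  have hb := (hηd (k+1)).fun_mul (hp (k+2)).1
  have hc := (hηd (k+2)).fun_mul (hp (k+1)).1
  refine ⟨(hNi.fun_mul (ha.fun_add (hb.fun_sub hc))).congr_of_eventuallyEq hev, ?_⟩
  rw [hev.fderiv_eq, fd_mul hNi (ha.fun_add (hb.fun_sub hc)), hDNi,
    fderiv_fun_add ha (hb.fun_sub hc), fderiv_fun_sub hb hc]
  simp only [add_apply, sub_apply]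
  rw [fd_mul hCψd (hξd k), fd_mul (hηd (k+1)) (hp (k+2)).1, fd_mul (hηd (k+2)) (hp (k+1)).1, hDC,
    (hp _).2, (hp _).2, hDη, hDη, hDξ]
  simp only [hform x hx]
  have hdiv := hdivξ x hx
  unfold ediv at hdiv
  rw [Fin.sum_univ_three] at hdiv
  generalize (gnormSq g ξ x)⁻¹ = N
  clear_value η
  have hdiv' : pd 0 (fun y => ξ y 0) x = - pd 1 (fun y => ξ y 1) x - pd 2 (fun y => ξ y 2) x := by
    linarith
  have e1 : (1 : Fin 3) + 1 = 2 := rfl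
  have e2 : (1 : Fin 3) + 2 = 0 := rfl
  have e3 : (2 : Fin 3) + 1 = 0 := rfl
  have e4 : (2 : Fin 3) + 2 = 1 := rfl
  fin_cases k <;>
    simp only [Fin.sum_univ_three, Fin.zero_eta, Fin.mk_one, Fin.reduceFinMk, zero_add,
      e1, e2, e3, e4, hdiv'] <;> ring

/-- quasisymmetry defect of `B_g` in terms of the Euclidean deformation
tensor of `ξ`. -/
theorem statement15 (U : Set Pt) (hU : IsOpen U)
    (g : Met3) (hg : SmoothMetricOn g U)
    (ξ : VF) (hξ : ContDiffOn ℝ (⊤ : ℕ∞) ξ U) (hξpos : ∀ x ∈ U, 0 < gnormSq g ξ x)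
    (hdivξ : ∀ x ∈ U, ediv ξ x = 0) (hKill : IsKillingOn g ξ U)
    (C : ℝ → ℝ) (hC : ContDiff ℝ (⊤ : ℕ∞) C)
    (ψ : Pt → ℝ) (hψ : ContDiffOn ℝ (⊤ : ℕ∞) ψ U)
    (horth : ∀ x ∈ U, edot ξ (egrad ψ) x = 0) :
    ∀ x ∈ U,
      edot ξ (egrad (edot (Bg g ξ C ψ) (Bg g ξ C ψ))) x
        = lieEuclPair ξ (Bg g ξ C ψ) (Bg g ξ C ψ) x ∧
      lieEuclPair ξ (Bg g ξ C ψ) (Bg g ξ C ψ) x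
        = ((gnormSq g ξ x) ^ 2)⁻¹ *
            ((C (ψ x)) ^ 2 * lieEuclPair ξ ξ ξ x
              + 2 * sdet g x * C (ψ x) * lieEuclPair ξ ξ (gcross g ξ (ggrad g ψ)) x
              + (g x).det *
                  lieEuclPair ξ (gcross g ξ (ggrad g ψ)) (gcross g ξ (ggrad g ψ)) x) ∧
      (Bg g ξ C ψ x ≠ 0 →
        (edot ξ (egrad (fun y => Real.sqrt (edot (Bg g ξ C ψ) (Bg g ξ C ψ) y))) x = 0 ↔
          (C (ψ x)) ^ 2 * lieEuclPair ξ ξ ξ x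
            + 2 * sdet g x * C (ψ x) * lieEuclPair ξ ξ (gcross g ξ (ggrad g ψ)) x
            + (g x).det *
                lieEuclPair ξ (gcross g ξ (ggrad g ψ)) (gcross g ξ (ggrad g ψ)) x = 0)) := by
  intro x hx
  have hT := Bg_transport U hU g hg ξ hξ hξpos hdivξ hKill C hC ψ hψ horth x hx
  have hdet : 0 < (g x).det := (hg.2 x hx).det_pos
  have hs : sdet g x * sdet g x = (g x).det := Real.mul_self_sqrt hdet.le
  have hN0 : gnormSq g ξ x ≠ 0 := (hξpos x hx).ne'
  have hBB : edot (Bg g ξ C ψ) (Bg g ξ C ψ) = fun y => ∑ i, Bg g ξ C ψ y i * Bg g ξ C ψ y i := rfl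
  have hBd : DifferentiableAt ℝ (edot (Bg g ξ C ψ) (Bg g ξ C ψ)) x := by
    rw [hBB]
    exact DifferentiableAt.fun_sum fun i _ => (hT i).1.fun_mul (hT i).1
  have h1 : edot ξ (egrad (edot (Bg g ξ C ψ) (Bg g ξ C ψ))) x
      = lieEuclPair ξ (Bg g ξ C ψ) (Bg g ξ C ψ) x := by
    rw [dir_eq, hBB, fd_sum (fun i => (hT i).1.fun_mul (hT i).1)]
    rw [Finset.sum_congr rfl fun l _ => fd_mul (hT l).1 (hT l).1 (ξ x)]
    simp only [(hT _).2, lieEuclPair, Fin.sum_univ_three]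
    ring
  have h2 : lieEuclPair ξ (Bg g ξ C ψ) (Bg g ξ C ψ) x
        = ((gnormSq g ξ x) ^ 2)⁻¹ *
            ((C (ψ x)) ^ 2 * lieEuclPair ξ ξ ξ x
              + 2 * sdet g x * C (ψ x) * lieEuclPair ξ ξ (gcross g ξ (ggrad g ψ)) x
              + (g x).det *
                  lieEuclPair ξ (gcross g ξ (ggrad g ψ)) (gcross g ξ (ggrad g ψ)) x) := by
    rw [← hs, ← inv_pow]
    simp only [lieEuclPair, Bg, Fin.sum_univ_three]
    ring
  refine ⟨h1, h2, fun hB => ?_⟩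
  have hpos : 0 < edot (Bg g ξ C ψ) (Bg g ξ C ψ) x := by
    obtain ⟨i, hi⟩ := Function.ne_iff.1 hB
    exact Finset.sum_pos' (fun j _ => mul_self_nonneg _) ⟨i, Finset.mem_univ _, mul_self_pos.2 hi⟩
  rw [dir_eq, (hBd.hasFDerivAt.sqrt hpos.ne').fderiv]
  rw [dir_eq, h2] at h1
  have hsq : 0 < Real.sqrt (edot (Bg g ξ C ψ) (Bg g ξ C ψ) x) := Real.sqrt_pos.2 hpos
  simp only [smul_apply, smul_eq_mul, h1]
  constructor
  · intro h
    rcases mul_eq_zero.1 h with h | h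
    · exfalso
      have : 0 < 1 / (2 * Real.sqrt (edot (Bg g ξ C ψ) (Bg g ξ C ψ) x)) := by positivity
      linarith
    · rcases mul_eq_zero.1 h with h | h
      · exact absurd h (inv_ne_zero (pow_ne_zero 2 hN0))
      · exact h
  · intro h
    rw [h]
    simp
end
end

section
/- Let g be a Riemannian metric on an open set U ⊆ ℝ³, let ξ be a smooth vector field on U with |ξ|²_g > 0, Euclidean divergence div ξ = 0, and which is a g-Killing field ((L_ξ g)_{ij} = 0 on U). Let C, P : ℝ → ℝ be smooth and ψ : U → ℝ smooth with ξ · ∇ψ = 0 and |∇_gψ|²_g > 0 on U. Define B_g := |ξ|_g^{-2}(C(ψ) ξ + √|g| (ξ ×_g ∇_gψ)). Then B_g satisfies the g-magnetohydrostatic equation without force, curl_g B_g ×_g B_g = ∇_g(P ∘ ψ), on U if and only if ψ satisfies the generalized Grad–Shafranov equation √|g| · div_g( √|g| ∇_gψ / |ξ|²_g ) + √|g| (C(ψ)/|ξ|⁴_g)(ξ ·_g curl_g ξ) + C(ψ)C′(ψ)/|ξ|²_g + P′(ψ) = 0 on U. -/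
noncomputable section

/-- Euclidean cross product on triples. -/
def cr3 (u v : Pt) : Pt :=
  ![u 1 * v 2 - u 2 * v 1, u 2 * v 0 - u 0 * v 2, u 0 * v 1 - u 1 * v 0]

/-- Curl of a Jacobian array `d i j = ∂ᵢ β_j`. -/
def cu3 (d : Fin 3 → Fin 3 → ℝ) : Pt :=
  ![d 1 2 - d 2 1, d 2 0 - d 0 2, d 0 1 - d 1 0]

/-- Lowered components. -/
def lo (g : Met3) (X : VF) (j : Fin 3) (y : Pt) : ℝ := ∑ p, g y j p * X y p

lemma eps_sum (h : Matrix (Fin 3) (Fin 3) ℝ) (m i j : Fin 3) :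
    ∑ n, ∑ k, ∑ l, h m n * h i k * h j l * eps k l n = h.det * eps i j m := by
  rw [Matrix.det_fin_three]
  fin_cases m <;> fin_cases i <;> fin_cases j <;>
    simp [Fin.sum_univ_three, eps] <;> ring

lemma sdet_pos (g : Met3) (x : Pt) (h : (g x).PosDef) : 0 < sdet g x :=
  Real.sqrt_pos.2 h.det_pos

lemma sdet_sq (g : Met3) (x : Pt) (h : (g x).PosDef) : sdet g x * sdet g x = (g x).det :=
  Real.mul_self_sqrt h.det_pos.le

lemma met_symm (g : Met3) (x : Pt) (h : (g x).PosDef) (i j : Fin 3) : g x i j = g x j i := by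
  have := h.isHermitian.apply i j
  simpa using this.symm

lemma mul_inv_of (g : Met3) (x : Pt) (h : (g x).PosDef) : g x * (g x)⁻¹ = 1 :=
  Matrix.mul_nonsing_inv _ (IsUnit.mk0 _ h.det_pos.ne')

lemma inv_mul_of (g : Met3) (x : Pt) (h : (g x).PosDef) : (g x)⁻¹ * g x = 1 :=
  Matrix.nonsing_inv_mul _ (IsUnit.mk0 _ h.det_pos.ne')

lemma gcurl_eq (g : Met3) (X : VF) (x : Pt) (h : (g x).PosDef) (m : Fin 3) :
    gcurl g X x m = (sdet g x)⁻¹ * cu3 (fun i j => pd i (lo g X j) x) m := by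
  have hs := sdet_pos g x h
  have hs2 := sdet_sq g x h
  have hd : ((g x)⁻¹).det = (sdet g x * sdet g x)⁻¹ := by
    rw [Matrix.det_nonsing_inv, hs2, Ring.inverse_eq_inv']
  have e : gcurl g X x m = sdet g x * ∑ i, ∑ j,
      (∑ n, ∑ k, ∑ l, (g x)⁻¹ m n * (g x)⁻¹ i k * (g x)⁻¹ j l * eps k l n) *
        pd i (lo g X j) x := by
    unfold gcurl
    change sdet g x * ∑ n, ∑ i, ∑ k, ∑ j, ∑ l,
      (g x)⁻¹ m n * (g x)⁻¹ i k * (g x)⁻¹ j l * eps k l n * pd i (lo g X j) x = _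
    congr 1
    simp only [Finset.sum_mul]
    rw [Finset.sum_comm]
    refine Finset.sum_congr rfl fun i _ => ?_
    rw [Finset.sum_comm]
    rw [Finset.sum_congr rfl (fun k _ => Finset.sum_comm)]
    rw [Finset.sum_comm]
    refine Finset.sum_congr rfl fun j _ => ?_
    rw [Finset.sum_comm]
  rw [e]
  simp only [eps_sum, hd]
  have : (sdet g x)⁻¹ = sdet g x * (sdet g x * sdet g x)⁻¹ := by field_simp
  rw [this]
  fin_cases m <;> simp [Fin.sum_univ_three, eps, cu3] <;> ring

lemma raise_lower (g : Met3) (x : Pt) (h : (g x).PosDef) (w : Pt) (j : Fin 3) :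
    ∑ k, g x j k * ∑ l, (g x)⁻¹ k l * w l = w j := by
  have := congrFun (congrArg (fun M => Matrix.mulVec M w) (mul_inv_of g x h)) j
  simp only [← Matrix.mulVec_mulVec, Matrix.one_mulVec] at this
  exact this

lemma lower_raise (g : Met3) (x : Pt) (h : (g x).PosDef) (w : Pt) (j : Fin 3) :
    ∑ k, (g x)⁻¹ j k * ∑ l, g x k l * w l = w j := by
  have := congrFun (congrArg (fun M => Matrix.mulVec M w) (inv_mul_of g x h)) j
  simp only [← Matrix.mulVec_mulVec, Matrix.one_mulVec] at this
  exact this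

lemma gcross_eq (g : Met3) (X Y : VF) (x : Pt) (k : Fin 3) :
    gcross g X Y x k = ∑ l, (g x)⁻¹ k l * (sdet g x * cr3 (X x) (Y x) l) := by
  unfold gcross
  simp [Fin.sum_univ_three, eps, cr3]
  ring

lemma lo_gcross (g : Met3) (X Y : VF) (x : Pt) (h : (g x).PosDef) (j : Fin 3) :
    lo g (gcross g X Y) j x = sdet g x * cr3 (X x) (Y x) j := by
  unfold lo
  simp only [gcross_eq]
  exact raise_lower g x h (fun l => sdet g x * cr3 (X x) (Y x) l) j

lemma lo_ggrad (g : Met3) (f : Pt → ℝ) (x : Pt) (h : (g x).PosDef) (j : Fin 3) :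
    lo g (ggrad g f) j x = pd j f x :=
  raise_lower g x h (fun l => pd l f x) j

lemma lo_inj (g : Met3) (X Y : VF) (x : Pt) (h : (g x).PosDef) :
    (∀ i, X x i = Y x i) ↔ ∀ j, lo g X j x = lo g Y j x := by
  constructor
  · intro H j
    simp [lo, H]
  · intro H i
    rw [← lower_raise g x h (X x) i, ← lower_raise g x h (Y x) i]
    exact Finset.sum_congr rfl fun k _ => by congr 1; exact H k

/-- cofactor identity -/
lemma cof_id (G : Matrix (Fin 3) (Fin 3) ℝ) (hs : ∀ i j, G i j = G j i) (u v : Pt) (j : Fin 3) :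
    ∑ p, G j p * cr3 (fun i => ∑ k, G i k * u k) (fun i => ∑ k, G i k * v k) p
      = G.det * cr3 u v j := by
  rw [Matrix.det_fin_three]
  have h1 := hs 1 0
  have h2 := hs 2 0
  have h3 := hs 2 1
  fin_cases j <;> simp [Fin.sum_univ_three, cr3, h1, h2, h3] <;> ring

/-- `N` times the lowered field. -/
lemma lo_Bg (g : Met3) (ξ : VF) (C : ℝ → ℝ) (ψ : Pt → ℝ) (x : Pt) (h : (g x).PosDef)
    (j : Fin 3) :
    lo g (Bg g ξ C ψ) j x = (gnormSq g ξ x)⁻¹ * (C (ψ x) * lo g ξ j x +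
      cr3 (ξ x) (fun i => (g x).det * ggrad g ψ x i) j) := by
  have e : lo g (Bg g ξ C ψ) j x = (gnormSq g ξ x)⁻¹ * (C (ψ x) * lo g ξ j x +
      sdet g x * lo g (gcross g ξ (ggrad g ψ)) j x) := by
    simp only [lo, Bg, Fin.sum_univ_three]; ring
  rw [e, lo_gcross g _ _ x h, ← sdet_sq g x h]
  congr 2
  fin_cases j <;> simp [cr3] <;> ring

lemma Bg_eq (g : Met3) (ξ : VF) (C : ℝ → ℝ) (ψ : Pt → ℝ) (x : Pt) (h : (g x).PosDef)
    (i : Fin 3) :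
    Bg g ξ C ψ x i = (gnormSq g ξ x)⁻¹ * (C (ψ x) * ξ x i +
      cr3 (fun j => lo g ξ j x) (fun j => pd j ψ x) i) := by
  revert i
  rw [lo_inj g (Bg g ξ C ψ) (fun x i => (gnormSq g ξ x)⁻¹ * (C (ψ x) * ξ x i +
      cr3 (fun j => lo g ξ j x) (fun j => pd j ψ x) i)) x h]
  intro j
  rw [lo_Bg g ξ C ψ x h]
  have := cof_id (g x) (met_symm g x h) (ξ x) (ggrad g ψ x) j
  have e2 : (fun i => ∑ k, g x i k * ggrad g ψ x k) = fun j => pd j ψ x :=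
    funext fun j => lo_ggrad g ψ x h j
  rw [e2] at this
  have e3 : cr3 (ξ x) (fun i => (g x).det * ggrad g ψ x i) j
      = (g x).det * cr3 (ξ x) (ggrad g ψ x) j := by
    fin_cases j <;> simp [cr3] <;> ring
  rw [e3, ← this]
  simp only [lo, Fin.sum_univ_three]
  ring

lemma cd_pd {f : Pt → ℝ} {x : Pt} (h : ContDiffAt ℝ (⊤ : ℕ∞) f x) (i : Fin 3) :
    ContDiffAt ℝ (⊤ : ℕ∞) (pd i f) x := by
  have := h.fderiv_right (m := ((⊤ : ℕ∞) : WithTop ℕ∞)) (by simp)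
  exact this.clm_apply contDiffAt_const

lemma cd_diff {f : Pt → ℝ} {x : Pt} (h : ContDiffAt ℝ (⊤ : ℕ∞) f x) :
    DifferentiableAt ℝ f x := h.differentiableAt (by simp)

lemma D_mul {f k : Pt → ℝ} {x : Pt} (hf : DifferentiableAt ℝ f x) (hk : DifferentiableAt ℝ k x)
    (v : Pt) : fderiv ℝ (fun y => f y * k y) x v = fderiv ℝ f x v * k x + f x * fderiv ℝ k x v := by
  rw [fderiv_fun_mul hf hk]; simp; ring

lemma D_add {f k : Pt → ℝ} {x : Pt} (hf : DifferentiableAt ℝ f x) (hk : DifferentiableAt ℝ k x)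
    (v : Pt) : fderiv ℝ (fun y => f y + k y) x v = fderiv ℝ f x v + fderiv ℝ k x v := by
  rw [fderiv_fun_add hf hk]; simp

lemma D_sub {f k : Pt → ℝ} {x : Pt} (hf : DifferentiableAt ℝ f x) (hk : DifferentiableAt ℝ k x)
    (v : Pt) : fderiv ℝ (fun y => f y - k y) x v = fderiv ℝ f x v - fderiv ℝ k x v := by
  rw [fderiv_fun_sub hf hk]; simp

lemma D_sum3 {f k : Fin 3 → Pt → ℝ} {x : Pt} (hf : ∀ i, DifferentiableAt ℝ (f i) x)
    (hk : ∀ i, DifferentiableAt ℝ (k i) x)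
    (v : Pt) : fderiv ℝ (fun y => ∑ i, f i y * k i y) x v
      = ∑ i, (fderiv ℝ (f i) x v * k i x + f i x * fderiv ℝ (k i) x v) := by
  rw [fderiv_fun_sum (A := fun i y => f i y * k i y) (fun i _ => (hf i).mul (hk i))]
  simp only [sum_apply]
  exact Finset.sum_congr rfl fun i _ => D_mul (hf i) (hk i) v

lemma D_dir (f : Pt → ℝ) (x v : Pt) : fderiv ℝ f x v = ∑ i, v i * pd i f x := by
  have : v = ∑ i, v i • (Pi.single i (1 : ℝ) : Pt) := by
    ext j; simp [Pi.single_apply]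
  conv_lhs => rw [this]
  simp [pd]

lemma D_congr {f k : Pt → ℝ} {U : Set Pt} (hU : IsOpen U) {x : Pt} (hx : x ∈ U)
    (h : ∀ y ∈ U, f y = k y) (v : Pt) : fderiv ℝ f x v = fderiv ℝ k x v := by
  have : f =ᶠ[nhds x] k := by
    filter_upwards [hU.mem_nhds hx] with y hy using h y hy
  rw [this.fderiv_eq]

/-- Killing equation in Lie derivative form. -/
lemma killing (g : Met3) (ξ : VF) (x : Pt) (h : (g x).PosDef)
    (hgd : ∀ i j, DifferentiableAt ℝ (fun y => g y i j) x)
    (hξd : ∀ i, DifferentiableAt ℝ (fun y => ξ y i) x)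
    (i j : Fin 3) (hK : lieMet g ξ x i j = 0) :
    fderiv ℝ (fun y => g y i j) x (ξ x)
      + ∑ k, (g x k j * pd i (fun y => ξ y k) x + g x i k * pd j (fun y => ξ y k) x) = 0 := by
  have hc : 2 * ∑ k, ∑ l, christoffel g x k i j * g x k l * ξ x l
      = ∑ l, ξ x l * (pd i (fun y => g y j l) x + pd j (fun y => g y i l) x
        - pd l (fun y => g y i j) x) := by
    obtain ⟨T, hT⟩ : ∃ T : Pt, T = fun l => pd i (fun y => g y j l) x + pd j (fun y => g y i l) x
        - pd l (fun y => g y i j) x := ⟨_, rfl⟩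
    have hch : ∀ k, christoffel g x k i j = (1 / 2) * ∑ l, (g x)⁻¹ k l * T l := by
      intro k; rw [hT]; rfl
    have hR : ∑ l, ξ x l * (pd i (fun y => g y j l) x + pd j (fun y => g y i l) x
        - pd l (fun y => g y i j) x) = ∑ l, ξ x l * ∑ k, g x l k * ∑ m, (g x)⁻¹ k m * T m := by
      refine Finset.sum_congr rfl fun l _ => ?_
      rw [raise_lower g x h T l, hT]
    rw [hR]
    simp only [hch]
    generalize (fun k => ∑ l, (g x)⁻¹ k l * T l) = S
    have s1 := met_symm g x h 1 0
    have s2 := met_symm g x h 2 0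
    have s3 := met_symm g x h 2 1
    simp only [Fin.sum_univ_three, s1, s2, s3]
    ring
  unfold lieMet at hK
  rw [hc] at hK
  have e1 : ∀ a b, pd a (fun y => ∑ l, g y b l * ξ y l) x = ∑ l,
      (pd a (fun y => g y b l) x * ξ x l + g x b l * pd a (fun y => ξ y l) x) :=
    fun a b => D_sum3 (f := fun l y => g y b l) (k := fun l y => ξ y l) (hgd b) hξd _
  rw [e1, e1] at hK
  rw [D_dir]
  have s1 := met_symm g x h 1 0
  have s2 := met_symm g x h 2 0
  have s3 := met_symm g x h 2 1
  simp only [Fin.sum_univ_three] at hK ⊢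
  rw [met_symm g x h 0 j, met_symm g x h 1 j, met_symm g x h 2 j]
  linarith

/-- Final pointwise algebra. -/
lemma final_alg (N C C' D : ℝ) (ξ η p V β G F dN b : Pt) (hN : N ≠ 0)
    (hNe : N = ∑ i, ξ i * η i) (hξp : ∑ i, ξ i * p i = 0)
    (hβ : ∀ j, β j = N⁻¹ * (C * η j + cr3 ξ V j))
    (hb : ∀ j, b j = N⁻¹ * (C * ξ j + cr3 η p j))
    (h1 : ∀ j, cr3 F ξ j = - (C' * p j))
    (h2 : ∀ j, cr3 G ξ j = - dN j)
    (h3 : D = ∑ i, F i * η i - ∑ i, β i * G i) (j : Fin 3) :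
    cr3 F b j = - (D / N - (∑ i, V i * dN i) / N ^ 2 + C / N ^ 2 * (∑ i, η i * G i)
      + C * C' / N) * p j := by
  have a0 := h1 0
  have a1 := h1 1
  have a2 := h1 2
  have c0 := h2 0
  have c1 := h2 1
  have c2 := h2 2
  have hFp : ∑ i, F i * p i = 0 := by
    have : N * ∑ i, F i * p i = 0 := by
      simp only [Fin.sum_univ_three] at *
      simp [cr3] at a0 a1 a2
      rw [hNe]
      linear_combination -(η 1 * p 2 - η 2 * p 1) * a0 - (η 2 * p 0 - η 0 * p 2) * a1
        - (η 0 * p 1 - η 1 * p 0) * a2 + (F 0 * η 0 + F 1 * η 1 + F 2 * η 2) * hξp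
    exact (mul_eq_zero.1 this).resolve_left hN
  have hβG : N * ∑ i, β i * G i = C * (∑ i, η i * G i) - ∑ i, V i * dN i := by
    simp only [Fin.sum_univ_three] at *
    simp [cr3] at c0 c1 c2
    simp only [hβ]
    field_simp
    simp [cr3]
    linear_combination V 0 * c0 + V 1 * c1 + V 2 * c2
  have key : D / N - (∑ i, V i * dN i) / N ^ 2 + C / N ^ 2 * (∑ i, η i * G i)
      + C * C' / N = N⁻¹ * (∑ i, F i * η i + C * C') := by
    have : C * (∑ i, η i * G i) = N * ∑ i, β i * G i + ∑ i, V i * dN i := by linarith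
    rw [h3]
    field_simp
    linear_combination this
  rw [key]
  have hj := h1 j
  have : N * cr3 F b j = -(∑ i, F i * η i + C * C') * p j := by
    simp only [Fin.sum_univ_three] at hFp ⊢
    have hb' : ∀ j, N * b j = C * ξ j + cr3 η p j := fun j => by rw [hb]; field_simp
    have b0 := hb' 0
    have b1 := hb' 1
    have b2 := hb' 2
    simp [cr3] at b0 b1 b2 a0 a1 a2
    fin_cases j <;> simp [cr3]
    · linear_combination F 1 * b2 - F 2 * b1 + C * a0 + η 0 * hFp
    · linear_combination F 2 * b0 - F 0 * b2 + C * a1 + η 1 * hFp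
    · linear_combination F 0 * b1 - F 1 * b0 + C * a2 + η 2 * hFp
  field_simp
  linarith


lemma cr3_smooth {u v : Fin 3 → Pt → ℝ} {x : Pt} (hu : ∀ i, ContDiffAt ℝ (⊤ : ℕ∞) (u i) x)
    (hv : ∀ i, ContDiffAt ℝ (⊤ : ℕ∞) (v i) x) (j : Fin 3) :
    ContDiffAt ℝ (⊤ : ℕ∞) (fun y => cr3 (fun i => u i y) (fun i => v i y) j) x := by
  fin_cases j
  · exact ((hu 1).mul (hv 2)).sub ((hu 2).mul (hv 1))
  · exact ((hu 2).mul (hv 0)).sub ((hu 0).mul (hv 2))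
  · exact ((hu 0).mul (hv 1)).sub ((hu 1).mul (hv 0))

lemma D_cr3 {u v : Fin 3 → Pt → ℝ} {x : Pt} (hu : ∀ i, DifferentiableAt ℝ (u i) x)
    (hv : ∀ i, DifferentiableAt ℝ (v i) x) (w : Pt) (j : Fin 3) :
    fderiv ℝ (fun y => cr3 (fun i => u i y) (fun i => v i y) j) x w
      = cr3 (fun i => fderiv ℝ (u i) x w) (fun i => v i x) j
        + cr3 (fun i => u i x) (fun i => fderiv ℝ (v i) x w) j := by
  have key : ∀ a b, fderiv ℝ (fun y => u a y * v b y - u b y * v a y) x w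
      = (fderiv ℝ (u a) x w * v b x - fderiv ℝ (u b) x w * v a x)
        + (u a x * fderiv ℝ (v b) x w - u b x * fderiv ℝ (v a) x w) := by
    intro a b
    rw [D_sub (f := fun y => u a y * v b y) (k := fun y => u b y * v a y)
      ((hu a).mul (hv b)) ((hu b).mul (hv a)), D_mul (hu a) (hv b), D_mul (hu b) (hv a)]
    ring
  fin_cases j
  · exact key 1 2
  · exact key 2 0
  · exact key 0 1

lemma lo_smooth {g : Met3} {X : VF} {x : Pt}
    (hg : ∀ i j, ContDiffAt ℝ (⊤ : ℕ∞) (fun y => g y i j) x)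
    (hX : ∀ i, ContDiffAt ℝ (⊤ : ℕ∞) (fun y => X y i) x) (j : Fin 3) :
    ContDiffAt ℝ (⊤ : ℕ∞) (lo g X j) x :=
  ContDiffAt.sum fun p _ => (hg j p).mul (hX p)

lemma gnormSq_eq (g : Met3) (X : VF) (x : Pt) : gnormSq g X x = ∑ i, X x i * lo g X i x := by
  simp only [gnormSq, gdot, lo, Fin.sum_univ_three]; ring

/-- Mixed partial derivatives commute. -/
lemma pd_comm {f : Pt → ℝ} {x : Pt} (h : ContDiffAt ℝ (⊤ : ℕ∞) f x) (i j : Fin 3) :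
    pd i (pd j f) x = pd j (pd i f) x := by
  have hd : DifferentiableAt ℝ (fderiv ℝ f) x :=
    (h.fderiv_right (m := ((⊤ : ℕ∞) : WithTop ℕ∞)) (by simp)).differentiableAt (by simp)
  have e : ∀ a b, pd a (pd b f) x
      = fderiv ℝ (fderiv ℝ f) x (Pi.single a 1) (Pi.single b 1) := by
    intro a b
    change fderiv ℝ (fun y => fderiv ℝ f y (Pi.single b 1)) x (Pi.single a 1) = _
    rw [fderiv_clm_apply hd (differentiableAt_const _)]
    simp
  rw [e, e]
  have hs : IsSymmSndFDerivAt ℝ f x := h.isSymmSndFDerivAt (by simp only [minSmoothness_of_isRCLikeNormedField]; exact WithTop.coe_le_coe.2 le_top)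
  exact hs _ _

/-- If `X` and `g` are invariant along `ξ`, so is the lowered field. -/
lemma lie_lo {g : Met3} {ξ X : VF} {x : Pt}
    (hgd : ∀ i j, DifferentiableAt ℝ (fun y => g y i j) x)
    (hXd : ∀ i, DifferentiableAt ℝ (fun y => X y i) x)
    (hK : ∀ i j, fderiv ℝ (fun y => g y i j) x (ξ x)
      + ∑ k, (g x k j * pd i (fun y => ξ y k) x + g x i k * pd j (fun y => ξ y k) x) = 0)
    (hX : ∀ i, fderiv ℝ (fun y => X y i) x (ξ x) = ∑ k, X x k * pd k (fun y => ξ y i) x)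
    (j : Fin 3) :
    fderiv ℝ (lo g X j) x (ξ x) = - ∑ k, lo g X k x * pd j (fun y => ξ y k) x := by
  have e : fderiv ℝ (lo g X j) x (ξ x) = ∑ p, (fderiv ℝ (fun y => g y j p) x (ξ x) * X x p
      + g x j p * fderiv ℝ (fun y => X y p) x (ξ x)) :=
    D_sum3 (f := fun p y => g y j p) (k := fun p y => X y p) (hgd j) hXd _
  rw [e]
  have h0 := hK j 0
  have h1 := hK j 1
  have h2 := hK j 2
  simp only [hX, lo, Fin.sum_univ_three] at *
  linear_combination X x 0 * h0 + X x 1 * h1 + X x 2 * h2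

/-- Cartan: contraction of the exterior derivative of an invariant one-form. -/
lemma cartan {U : Set Pt} (hU : IsOpen U) {ξ : VF} {β : Fin 3 → Pt → ℝ} {f : Pt → ℝ} {x : Pt}
    (hx : x ∈ U) (hξd : ∀ i, DifferentiableAt ℝ (fun y => ξ y i) x)
    (hβd : ∀ i, DifferentiableAt ℝ (β i) x)
    (hL : ∀ j, fderiv ℝ (β j) x (ξ x) = - ∑ k, β k x * pd j (fun y => ξ y k) x)
    (hf : ∀ y ∈ U, ∑ i, ξ y i * β i y = f y) (j : Fin 3) :
    cr3 (cu3 (fun i j => pd i (β j) x)) (ξ x) j = - pd j f x := by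
  have e : ∀ j, pd j f x = ∑ i, (pd j (fun y => ξ y i) x * β i x + ξ x i * pd j (β i) x) := by
    intro j
    have := D_sum3 (f := fun i y => ξ y i) (k := β) hξd hβd (Pi.single j 1)
    rw [D_congr hU hx hf] at this
    exact this
  rw [e]
  have h := hL j
  rw [D_dir] at h
  simp only [Fin.sum_univ_three] at *
  fin_cases j <;> simp [cr3, cu3] at h ⊢ <;> linear_combination h

theorem core (U : Set Pt) (hU : IsOpen U)
    (g : Met3) (hg : SmoothMetricOn g U)
    (ξ : VF) (hξ : ContDiffOn ℝ (⊤ : ℕ∞) ξ U) (hξpos : ∀ x ∈ U, 0 < gnormSq g ξ x)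
    (hdivξ : ∀ x ∈ U, ediv ξ x = 0) (hKill : IsKillingOn g ξ U)
    (C : ℝ → ℝ) (hC : ContDiff ℝ (⊤ : ℕ∞) C)
    (ψ : Pt → ℝ) (hψ : ContDiffOn ℝ (⊤ : ℕ∞) ψ U)
    (horth : ∀ x ∈ U, edot ξ (egrad ψ) x = 0) (x : Pt) (hx : x ∈ U) (j : Fin 3) :
    lo g (gcross g (gcurl g (Bg g ξ C ψ)) (Bg g ξ C ψ)) j x =
      - (sdet g x * gdiv g (fun y j => sdet g y * ggrad g ψ y j / gnormSq g ξ y) x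
          + sdet g x * (C (ψ x) / (gnormSq g ξ x) ^ 2) * gdot g ξ (gcurl g ξ) x
          + C (ψ x) * deriv C (ψ x) / gnormSq g ξ x) * pd j ψ x := by
  have hpd := hg.2
  have hnh := hU.mem_nhds hx
  have hgc : ∀ i j, ContDiffAt ℝ (⊤ : ℕ∞) (fun y => g y i j) x :=
    fun i j => (hg.1 i j).contDiffAt hnh
  have hξc : ∀ i, ContDiffAt ℝ (⊤ : ℕ∞) (fun y => ξ y i) x :=
    fun i => contDiffAt_pi.1 (hξ.contDiffAt hnh) i
  have hψc : ContDiffAt ℝ (⊤ : ℕ∞) ψ x := hψ.contDiffAt hnh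
  have hCψ : ContDiffAt ℝ (⊤ : ℕ∞) (fun y => C (ψ y)) x := hC.contDiffAt.comp x hψc
  have hgd := fun i j => cd_diff (hgc i j)
  have hξd := fun i => cd_diff (hξc i)
  have hψd := cd_diff hψc
  have hpψ : ∀ i, ContDiffAt ℝ (⊤ : ℕ∞) (pd i ψ) x := cd_pd hψc
  have hηc : ∀ i, ContDiffAt ℝ (⊤ : ℕ∞) (lo g ξ i) x := lo_smooth hgc hξc
  have hNc : ContDiffAt ℝ (⊤ : ℕ∞) (gnormSq g ξ) x := by
    rw [funext (gnormSq_eq g ξ)]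
    exact ContDiffAt.sum fun p _ => (hξc p).mul (hηc p)
  have hN0 : gnormSq g ξ x ≠ 0 := (hξpos x hx).ne'
  have hNd := cd_diff hNc
  -- the field
  have hBc : ∀ i, ContDiffAt ℝ (⊤ : ℕ∞) (fun y => Bg g ξ C ψ y i) x := by
    intro i
    have h0 : ContDiffAt ℝ (⊤ : ℕ∞) (fun y => (gnormSq g ξ y)⁻¹ * (C (ψ y) * ξ y i +
      cr3 (fun j => lo g ξ j y) (fun j => pd j ψ y) i)) x :=
      (hNc.inv hN0).mul ((hCψ.mul (hξc i)).add (cr3_smooth hηc hpψ i))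
    refine h0.congr_of_eventuallyEq ?_
    filter_upwards [hnh] with y hy using Bg_eq g ξ C ψ y (hpd y hy) i
  have hBd := fun i => cd_diff (hBc i)
  have hβc : ∀ i, ContDiffAt ℝ (⊤ : ℕ∞) (lo g (Bg g ξ C ψ) i) x := lo_smooth hgc hBc
  -- Killing
  have hK : ∀ i j, fderiv ℝ (fun y => g y i j) x (ξ x)
      + ∑ k, (g x k j * pd i (fun y => ξ y k) x + g x i k * pd j (fun y => ξ y k) x) = 0 :=
    fun i j => killing g ξ x (hpd x hx) hgd hξd i j (hKill x hx i j)
  have hLη := lie_lo hgd hξd hK (fun i => D_dir _ _ _)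
  -- invariance of N
  have hcη := cartan hU (f := gnormSq g ξ) hx hξd (fun i => cd_diff (hηc i)) hLη
    (fun y _ => (gnormSq_eq g ξ y).symm)
  have hDN : fderiv ℝ (gnormSq g ξ) x (ξ x) = 0 := by
    rw [D_dir]
    have h0 := hcη 0
    have h1 := hcη 1
    have h2 := hcη 2
    simp [cr3] at h0 h1 h2
    simp only [Fin.sum_univ_three]
    linear_combination ξ x 0 * h0 + ξ x 1 * h1 + ξ x 2 * h2
  have hDψ : fderiv ℝ ψ x (ξ x) = 0 := by
    rw [D_dir]; exact horth x hx
  have hpC : ∀ v, fderiv ℝ (fun y => C (ψ y)) x v = deriv C (ψ x) * fderiv ℝ ψ x v := by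
    intro v
    have h1 : HasDerivAt C (deriv C (ψ x)) (ψ x) :=
      (hC.differentiable (by simp) (ψ x)).hasDerivAt
    have := (h1.comp_hasFDerivAt x hψd.hasFDerivAt).fderiv
    change fderiv ℝ (C ∘ ψ) x v = _
    rw [this]; simp
  have hDp : ∀ j, fderiv ℝ (pd j ψ) x (ξ x) = - ∑ k, pd k ψ x * pd j (fun y => ξ y k) x := by
    intro j
    have h := D_sum3 (f := fun i y => ξ y i) (k := fun i => pd i ψ) hξd (fun i => cd_diff (hpψ i))
      (Pi.single j 1)
    rw [D_congr hU hx (f := fun y => ∑ i, ξ y i * pd i ψ y) (k := fun _ => 0) horth] at h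
    rw [D_dir]
    have h' : (0 : ℝ) = ∑ i, (pd j (fun y => ξ y i) x * pd i ψ x + ξ x i * pd j (pd i ψ) x) := by
      refine Eq.trans ?_ h
      simp
    simp only [Fin.sum_univ_three] at *
    rw [pd_comm hψc 0 j, pd_comm hψc 1 j, pd_comm hψc 2 j]
    linarith
  -- invariance of B
  have hLB : ∀ i, fderiv ℝ (fun y => Bg g ξ C ψ y i) x (ξ x)
      = ∑ k, Bg g ξ C ψ x k * pd k (fun y => ξ y i) x := by
    intro i
    have e : fderiv ℝ (fun y => gnormSq g ξ y * Bg g ξ C ψ y i) x (ξ x)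
        = fderiv ℝ (fun y => C (ψ y) * ξ y i
          + cr3 (fun j => lo g ξ j y) (fun j => pd j ψ y) i) x (ξ x) := by
      refine D_congr hU hx (fun y hy => ?_) _
      rw [Bg_eq g ξ C ψ y (hpd y hy) i]
      have := (hξpos y hy).ne'
      field_simp
    rw [D_mul hNd (hBd i), hDN, D_add (cd_diff (hCψ.mul (hξc i))) (cd_diff (cr3_smooth hηc hpψ i)),
      D_mul (cd_diff hCψ) (hξd i), hpC, hDψ,
      D_cr3 (fun i => cd_diff (hηc i)) (fun i => cd_diff (hpψ i))] at e
    simp only [hLη, hDp] at e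
    rw [D_dir (fun y => ξ y i)] at e
    refine mul_left_cancel₀ hN0 ?_
    have hb : ∀ k, gnormSq g ξ x * Bg g ξ C ψ x k = C (ψ x) * ξ x k +
        cr3 (fun j => lo g ξ j x) (fun j => pd j ψ x) k := by
      intro k
      rw [Bg_eq g ξ C ψ x (hpd x hx) k]
      field_simp
    have b0 := hb 0
    have b1 := hb 1
    have b2 := hb 2
    have hdv := hdivξ x hx
    clear hb
    simp only [ediv, Fin.sum_univ_three] at *
    simp [cr3] at b0 b1 b2
    fin_cases i <;> simp [cr3, -mul_eq_mul_left_iff] at e ⊢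
    · linear_combination e - pd 0 (fun y => ξ y 0) x * b0 - pd 1 (fun y => ξ y 0) x * b1
        - pd 2 (fun y => ξ y 0) x * b2
        - (lo g ξ 1 x * pd 2 ψ x - lo g ξ 2 x * pd 1 ψ x) * hdv
    · linear_combination e - pd 0 (fun y => ξ y 1) x * b0 - pd 1 (fun y => ξ y 1) x * b1
        - pd 2 (fun y => ξ y 1) x * b2
        - (lo g ξ 2 x * pd 0 ψ x - lo g ξ 0 x * pd 2 ψ x) * hdv
    · linear_combination e - pd 0 (fun y => ξ y 2) x * b0 - pd 1 (fun y => ξ y 2) x * b1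
        - pd 2 (fun y => ξ y 2) x * b2
        - (lo g ξ 0 x * pd 1 ψ x - lo g ξ 1 x * pd 0 ψ x) * hdv
  have hLβ := lie_lo hgd hBd hK hLB
  have hcβ := cartan hU (f := fun y => C (ψ y)) hx hξd (fun i => cd_diff (hβc i)) hLβ (by
    intro y hy
    simp only [lo_Bg g ξ C ψ y (hpd y hy)]
    have h0 := (hξpos y hy).ne'
    have h1 := gnormSq_eq g ξ y
    refine mul_left_cancel₀ h0 ?_
    simp only [Fin.sum_univ_three] at h1 ⊢
    simp [cr3, -mul_eq_mul_left_iff]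
    field_simp
    linear_combination -C (ψ y) * h1)
  -- V
  have hV : ∀ i, ∀ y ∈ U, (g y).det * ggrad g ψ y i
      = cr3 (fun j => lo g (Bg g ξ C ψ) j y) (fun j => lo g ξ j y) i := by
    intro i y hy
    have h0 := (hξpos y hy).ne'
    have h1 := gnormSq_eq g ξ y
    have h2 : ∑ k, ggrad g ψ y k * lo g ξ k y = 0 := by
      have : ∑ k, ggrad g ψ y k * lo g ξ k y = ∑ k, ξ y k * lo g (ggrad g ψ) k y := by
        have s1 := met_symm g y (hpd y hy) 1 0
        have s2 := met_symm g y (hpd y hy) 2 0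
        have s3 := met_symm g y (hpd y hy) 2 1
        simp only [lo, Fin.sum_univ_three, s1, s2, s3]; ring
      rw [this]
      simp only [lo_ggrad g ψ y (hpd y hy)]
      exact horth y hy
    have h3 := lo_Bg g ξ C ψ y (hpd y hy)
    simp only [h3]
    refine mul_left_cancel₀ h0 ?_
    generalize (g y).det = d at *
    simp only [Fin.sum_univ_three] at h1 h2
    fin_cases i <;> simp [cr3, -mul_eq_mul_left_iff] <;> field_simp
    · linear_combination d * ggrad g ψ y 0 * h1 + d * ξ y 0 * h2
    · linear_combination d * ggrad g ψ y 1 * h1 + d * ξ y 1 * h2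
    · linear_combination d * ggrad g ψ y 2 * h1 + d * ξ y 2 * h2
  have hVc : ∀ i, ContDiffAt ℝ (⊤ : ℕ∞) (fun y => (g y).det * ggrad g ψ y i) x := by
    intro i
    refine (cr3_smooth hβc hηc i).congr_of_eventuallyEq ?_
    filter_upwards [hnh] with y hy using hV i y hy
  have hpV : ∀ a i, pd a (fun y => (g y).det * ggrad g ψ y i) x
      = cr3 (fun i => pd a (lo g (Bg g ξ C ψ) i) x) (fun j => lo g ξ j x) i
        + cr3 (fun j => lo g (Bg g ξ C ψ) j x) (fun i => pd a (lo g ξ i) x) i := by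
    intro a i
    have := D_congr hU hx (hV i) (Pi.single a 1)
    rw [D_cr3 (fun i => cd_diff (hβc i)) (fun i => cd_diff (hηc i))] at this
    exact this
  have hs := sdet_pos g x (hpd x hx)
  have hdiv : sdet g x * gdiv g (fun y j => sdet g y * ggrad g ψ y j / gnormSq g ξ y) x
      = (∑ i, pd i (fun y => (g y).det * ggrad g ψ y i) x) / gnormSq g ξ x
        - (∑ i, ((g x).det * ggrad g ψ x i) * pd i (gnormSq g ξ) x) / gnormSq g ξ x ^ 2 := by
    unfold gdiv
    rw [← mul_assoc, mul_inv_cancel₀ hs.ne', one_mul]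
    have key : ∀ i, pd i (fun y => sdet g y * (sdet g y * ggrad g ψ y i / gnormSq g ξ y)) x
        = pd i (fun y => (g y).det * ggrad g ψ y i) x / gnormSq g ξ x
         - ((g x).det * ggrad g ψ x i) * pd i (gnormSq g ξ) x / gnormSq g ξ x ^ 2 := by
      intro i
      have e1 : ∀ y ∈ U, sdet g y * (sdet g y * ggrad g ψ y i / gnormSq g ξ y)
          = (g y).det * ggrad g ψ y i * (gnormSq g ξ y)⁻¹ := by
        intro y hy
        rw [← sdet_sq g y (hpd y hy)]; ring
      have hZ : DifferentiableAt ℝ (fun y => (g y).det * ggrad g ψ y i * (gnormSq g ξ y)⁻¹) x :=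
        cd_diff ((hVc i).mul (hNc.inv hN0))
      have e2 := D_mul hZ hNd (Pi.single i 1)
      have e3 : fderiv ℝ (fun y => ((g y).det * ggrad g ψ y i * (gnormSq g ξ y)⁻¹) * gnormSq g ξ y)
          x (Pi.single i 1) = pd i (fun y => (g y).det * ggrad g ψ y i) x := by
        refine D_congr hU hx (fun y hy => ?_) _
        have := (hξpos y hy).ne'
        field_simp
      have e4 : pd i (fun y => sdet g y * (sdet g y * ggrad g ψ y i / gnormSq g ξ y)) x
          = fderiv ℝ (fun y => (g y).det * ggrad g ψ y i * (gnormSq g ξ y)⁻¹) x (Pi.single i 1) :=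
        D_congr hU hx e1 _
      rw [e4, ← e3, e2]
      change _ = _ - _ * fderiv ℝ (gnormSq g ξ) x (Pi.single i 1) / _
      field_simp
      ring
    simp only [key, Finset.sum_sub_distrib, Finset.sum_div]
  have hcurl : gdot g ξ (gcurl g ξ) x
      = (sdet g x)⁻¹ * ∑ i, lo g ξ i x * cu3 (fun i j => pd i (lo g ξ j) x) i := by
    simp only [gdot, gcurl_eq g ξ x (hpd x hx)]
    have s1 := met_symm g x (hpd x hx) 1 0
    have s2 := met_symm g x (hpd x hx) 2 0
    have s3 := met_symm g x (hpd x hx) 2 1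
    generalize cu3 (fun i j => pd i (lo g ξ j) x) = G
    simp only [lo, Fin.sum_univ_three, s1, s2, s3]
    ring
  have hfin := final_alg (gnormSq g ξ x) (C (ψ x)) (deriv C (ψ x))
    (∑ i, pd i (fun y => (g y).det * ggrad g ψ y i) x) (ξ x) (fun j => lo g ξ j x)
    (fun j => pd j ψ x) (fun i => (g x).det * ggrad g ψ x i)
    (fun j => lo g (Bg g ξ C ψ) j x) (cu3 (fun i j => pd i (lo g ξ j) x))
    (cu3 (fun i j => pd i (lo g (Bg g ξ C ψ) j) x)) (fun i => pd i (gnormSq g ξ) x)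
    (Bg g ξ C ψ x) hN0 (gnormSq_eq g ξ x) (horth x hx)
    (lo_Bg g ξ C ψ x (hpd x hx)) (Bg_eq g ξ C ψ x (hpd x hx))
    (fun j => by rw [hcβ j]; exact congrArg Neg.neg (hpC _)) hcη
    (by
      simp only [hpV, Fin.sum_univ_three]
      simp [cr3, cu3]
      ring) j
  rw [lo_gcross g _ _ x (hpd x hx)]
  have hJ : sdet g x * cr3 (gcurl g (Bg g ξ C ψ) x) (Bg g ξ C ψ x) j
      = cr3 (cu3 (fun i j => pd i (lo g (Bg g ξ C ψ) j) x)) (Bg g ξ C ψ x) j := by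
    have := gcurl_eq g (Bg g ξ C ψ) x (hpd x hx)
    generalize cu3 (fun i j => pd i (lo g (Bg g ξ C ψ) j) x) = F at *
    fin_cases j <;> simp [cr3, this] <;> field_simp
  rw [hJ, hfin, hdiv, hcurl]
  field_simp

/-- `B_g` solves force-free `g`-MHS iff `ψ` solves the generalized
Grad–Shafranov equation. -/
theorem statement17 (U : Set Pt) (hU : IsOpen U)
    (g : Met3) (hg : SmoothMetricOn g U)
    (ξ : VF) (hξ : ContDiffOn ℝ (⊤ : ℕ∞) ξ U) (hξpos : ∀ x ∈ U, 0 < gnormSq g ξ x)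
    (hdivξ : ∀ x ∈ U, ediv ξ x = 0) (hKill : IsKillingOn g ξ U)
    (C P : ℝ → ℝ) (hC : ContDiff ℝ (⊤ : ℕ∞) C) (hP : ContDiff ℝ (⊤ : ℕ∞) P)
    (ψ : Pt → ℝ) (hψ : ContDiffOn ℝ (⊤ : ℕ∞) ψ U)
    (horth : ∀ x ∈ U, edot ξ (egrad ψ) x = 0)
    (hgradpos : ∀ x ∈ U, 0 < gnormSq g (ggrad g ψ) x) :
    (∀ x ∈ U, ∀ i,
        gcross g (gcurl g (Bg g ξ C ψ)) (Bg g ξ C ψ) x i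
          = ggrad g (fun y => P (ψ y)) x i) ↔
    (∀ x ∈ U,
        sdet g x * gdiv g (fun y j => sdet g y * ggrad g ψ y j / gnormSq g ξ y) x
          + sdet g x * (C (ψ x) / (gnormSq g ξ x) ^ 2) * gdot g ξ (gcurl g ξ) x
          + C (ψ x) * deriv C (ψ x) / gnormSq g ξ x
          + deriv P (ψ x) = 0) := by
  have hpd := hg.2
  have core' := core U hU g hg ξ hξ hξpos hdivξ hKill C hC ψ hψ horth
  have hpP : ∀ x ∈ U, ∀ j, pd j (fun y => P (ψ y)) x = deriv P (ψ x) * pd j ψ x := by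
    intro x hx j
    have h1 : HasDerivAt P (deriv P (ψ x)) (ψ x) :=
      (hP.differentiable (by simp) (ψ x)).hasDerivAt
    have h2 := cd_diff (hψ.contDiffAt (hU.mem_nhds hx))
    have := (h1.comp_hasFDerivAt x h2.hasFDerivAt).fderiv
    change fderiv ℝ (P ∘ ψ) x _ = _
    rw [this]; simp [pd]
  refine forall₂_congr fun x hx => ?_
  rw [lo_inj g _ (ggrad g (fun y => P (ψ y))) x (hpd x hx)]
  simp only [core' x hx, lo_ggrad g _ x (hpd x hx), hpP x hx]
  constructor
  · intro H
    obtain ⟨j, hj⟩ : ∃ j, pd j ψ x ≠ 0 := by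
      by_contra! hc
      have := hgradpos x hx
      simp [gnormSq, gdot, ggrad, hc] at this
    have := mul_right_cancel₀ hj (H j)
    linarith
  · intro H j
    congr 1
    linarith
end
end
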